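/- The McKinsey axiom is not first-order definable over finite frames: there is no first-order sentence φ over the signature with one binary relation symbol R such that for every finite Kripke frame F=(W,R), F validates □◇p → ◇□p if and only if F ⊨ φ. -/

import Mathlib

/-- A Kripke frame `(W, R)`. -/
structure Frame1 where
  W : Type
  R : W → W → Prop

/-- Basic modal formulas with propositional variables indexed by `ℕ`. -/
inductive BForm : Type
  | bot : BForm
  | var : ℕ → BForm
  | neg : BForm → BForm
  | and : BForm → BForm → BForm
  | or : BForm → BForm → BForm
  | imp : BForm → BForm → BForm
  | dia : BForm → BForm
  | box : BForm → BForm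

/-- Kripke semantics. -/
def BSat (F : Frame1) (V : ℕ → Set F.W) : F.W → BForm → Prop
  | _, .bot => False
  | w, .var p => w ∈ V p
  | w, .neg φ => ¬ BSat F V w φ
  | w, .and φ ψ => BSat F V w φ ∧ BSat F V w ψ
  | w, .or φ ψ => BSat F V w φ ∨ BSat F V w ψ
  | w, .imp φ ψ => BSat F V w φ → BSat F V w ψ
  | w, .dia φ => ∃ v, F.R w v ∧ BSat F V v φ
  | w, .box φ => ∀ v, F.R w v → BSat F V v φ

/-- `φ` is valid on the frame `F`: true at every world of every Kripke model
based on `F`. -/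
def BValidOn (F : Frame1) (φ : BForm) : Prop :=
  ∀ (V : ℕ → Set F.W) (w : F.W), BSat F V w φ

/-- The McKinsey axiom `□◇p → ◇□p`. -/
def mckinsey : BForm := .imp (.box (.dia (.var 0))) (.dia (.box (.var 0)))

/-- First-order formulas over the signature with a single binary relation
symbol `R`, with variables indexed by `ℕ`. -/
inductive FO1 : Type
  | eq : ℕ → ℕ → FO1
  | rel : ℕ → ℕ → FO1
  | fal : FO1
  | neg : FO1 → FO1
  | and : FO1 → FO1 → FO1
  | or : FO1 → FO1 → FO1
  | imp : FO1 → FO1 → FO1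
  | ex : ℕ → FO1 → FO1
  | all : ℕ → FO1 → FO1

/-- Tarskian satisfaction of a first-order formula in a frame, relative to an
assignment `g`. -/
def FO1Sat (F : Frame1) : (ℕ → F.W) → FO1 → Prop
  | g, .eq x y => g x = g y
  | g, .rel x y => F.R (g x) (g y)
  | _, .fal => False
  | g, .neg φ => ¬ FO1Sat F g φ
  | g, .and φ ψ => FO1Sat F g φ ∧ FO1Sat F g ψ
  | g, .or φ ψ => FO1Sat F g φ ∨ FO1Sat F g ψ
  | g, .imp φ ψ => FO1Sat F g φ → FO1Sat F g ψ
  | g, .ex x φ => ∃ d : F.W, FO1Sat F (Function.update g x d) φ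
  | g, .all x φ => ∀ d : F.W, FO1Sat F (Function.update g x d) φ

/-- Free variables. -/
def FO1.freeVars : FO1 → Finset ℕ
  | .eq x y => {x, y}
  | .rel x y => {x, y}
  | .fal => ∅
  | .neg φ => φ.freeVars
  | .and φ ψ => φ.freeVars ∪ ψ.freeVars
  | .or φ ψ => φ.freeVars ∪ ψ.freeVars
  | .imp φ ψ => φ.freeVars ∪ ψ.freeVars
  | .ex x φ => φ.freeVars \ {x}
  | .all x φ => φ.freeVars \ {x}

/-- Truth of a (closed) first-order formula in a frame. -/
def FrameSat1 (F : Frame1) (φ : FO1) : Prop :=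
  ∀ g : ℕ → F.W, FO1Sat F g φ

namespace McKinseyFinite

/-- The `n`-cycle as a three-layered frame: every world of layer `0` sees all of layer `1`
(the edges), an edge sees its two endpoints in layer `2`, and a vertex sees only itself. -/
abbrev cycleFrame (n : ℕ) : Frame1 where
  W := Fin 3 × Fin n
  R u v :=
    (u.1 = 0 ∧ v.1 = 1) ∨
    (u.1 = 1 ∧ v.1 = 2 ∧
      (v.2.1 = u.2.1 ∨ v.2.1 = u.2.1 + 1 ∨ (u.2.1 + 1 = n ∧ v.2.1 = 0))) ∨
    (u.1 = 2 ∧ v.1 = 2 ∧ v.2.1 = u.2.1)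

instance (n : ℕ) : Finite (cycleFrame n).W :=
  inferInstanceAs (Finite (Fin 3 × Fin n))

/-- At a world with a successor whose only successor is itself, the McKinsey axiom holds. -/
lemma sat_mckinsey_of_isolated_successor {F : Frame1} (V : ℕ → Set F.W) {w v : F.W}
    (hwv : F.R w v) (hv : ∀ u, F.R v u → u = v) : BSat F V w mckinsey := by
  intro h
  obtain ⟨u, hu, hp⟩ := h v hwv
  obtain rfl := hv u hu
  refine ⟨u, hwv, fun z hz => ?_⟩
  obtain rfl := hv z hz
  exact hp

lemma cycleFrame_vertex_isolated {n : ℕ} (i : Fin n) (u : (cycleFrame n).W)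
    (hu : (cycleFrame n).R ((2, i) : Fin 3 × Fin n) u) : u = ((2, i) : Fin 3 × Fin n) := by
  obtain ⟨k, j⟩ := u
  rcases hu with ⟨h, -⟩ | ⟨h, -⟩ | ⟨-, h, h'⟩
  · simp at h
  · simp at h
  · exact Prod.ext h (Fin.ext h')

lemma cycleFrame_valid_of_odd {n : ℕ} (hn : Odd n) : BValidOn (cycleFrame n) mckinsey := by
  rintro V ⟨k, r⟩
  have hk : k = 0 ∨ k = 1 ∨ k = 2 := by fin_cases k <;> simp
  rcases hk with rfl | rfl | rfl
  · intro hbox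
    by_contra hdia
    set c : ℕ → Prop := fun i => ∃ h : i < n, ((2, ⟨i, h⟩) : Fin 3 × Fin n) ∈ V 0
    have hedge : ∀ i < n, ∀ j, (j = i + 1 ∧ j < n ∨ i + 1 = n ∧ j = 0) → (c j ↔ ¬ c i) := by
      intro i hi j hj
      have hRe : (cycleFrame n).R ((0, r) : Fin 3 × Fin n) ((1, ⟨i, hi⟩) : Fin 3 × Fin n) :=
        Or.inl ⟨rfl, rfl⟩
      have hsucc : ∀ u : (cycleFrame n).W,
          (cycleFrame n).R ((1, ⟨i, hi⟩) : Fin 3 × Fin n) u →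
          (u ∈ V 0 ↔ c i) ∨ (u ∈ V 0 ↔ c j) := by
        rintro ⟨k, l, hl⟩ hu
        rcases hu with ⟨h, -⟩ | ⟨-, h, h'⟩ | ⟨h, -⟩
        · simp at h
        · simp only at h h'
          subst h
          have hlij : l = i ∨ l = j := by omega
          have hcl : (((2, ⟨l, hl⟩) : Fin 3 × Fin n) ∈ V 0 ↔ c l) :=
            ⟨fun h => ⟨hl, h⟩, fun ⟨_, h⟩ => h⟩
          rcases hlij with rfl | rfl
          · exact Or.inl hcl
          · exact Or.inr hcl
        · simp at h
      obtain ⟨u, hu, hup⟩ := hbox _ hRe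
      have hnb : ∃ v, (cycleFrame n).R ((1, ⟨i, hi⟩) : Fin 3 × Fin n) v ∧ v ∉ V 0 := by
        by_contra hcon
        push Not at hcon
        exact hdia ⟨_, hRe, fun v hv => hcon v hv⟩
      obtain ⟨v, hv, hvp⟩ := hnb
      have hup' : u ∈ V 0 := hup
      have h1 := hsucc u hu
      have h2 := hsucc v hv
      rw [iff_true_left hup', iff_true_left hup'] at h1
      rw [iff_false_left hvp, iff_false_left hvp] at h2
      exact ⟨fun hj hi => h2.elim (· hi) (· hj), fun hi => h1.resolve_left hi⟩
    have hpar : ∀ i < n, (c i ↔ (c 0 ↔ Even i)) := by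
      intro i
      induction i with
      | zero => simp
      | succ i ih =>
        intro hi
        have h1 := hedge i (by omega) (i + 1) (Or.inl ⟨rfl, hi⟩)
        have h2 := ih (by omega)
        have h3 := Nat.even_add_one (n := i)
        tauto
    obtain ⟨m, rfl⟩ := hn
    have h1 := hpar (2 * m) (by omega)
    have h2 := hedge (2 * m) (by omega) 0 (Or.inr ⟨rfl, rfl⟩)
    have h3 : Even (2 * m) := even_two_mul m
    tauto
  · exact sat_mckinsey_of_isolated_successor V (v := ((2, r) : Fin 3 × Fin n))
      (Or.inr (Or.inl ⟨rfl, rfl, Or.inl rfl⟩)) (cycleFrame_vertex_isolated r)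
  · exact sat_mckinsey_of_isolated_successor V (v := ((2, r) : Fin 3 × Fin n))
      (Or.inr (Or.inr ⟨rfl, rfl, rfl⟩)) (cycleFrame_vertex_isolated r)

lemma cycleFrame_not_valid_of_even {n : ℕ} (hn : Even n) (hpos : 0 < n) :
    ¬ BValidOn (cycleFrame n) mckinsey := by
  intro h
  have hends : ∀ b : Bool, ∀ v : (cycleFrame n).W,
      (cycleFrame n).R ((0, ⟨0, hpos⟩) : Fin 3 × Fin n) v →
      ∃ u : (cycleFrame n).W, (cycleFrame n).R v u ∧ (Even u.2.1 ↔ b = true) := by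
    rintro b ⟨k, i, hi⟩ hv
    have hk : k = 1 := by
      rcases hv with ⟨-, h⟩ | ⟨h, -⟩ | ⟨h, -⟩
      · exact h
      · simp at h
      · simp at h
    subst hk
    by_cases hib : Even i ↔ b = true
    · exact ⟨((2, ⟨i, hi⟩) : Fin 3 × Fin n), Or.inr (Or.inl ⟨rfl, rfl, Or.inl rfl⟩), hib⟩
    · have h3 := Nat.even_add_one (n := i)
      by_cases hin : i + 1 = n
      · refine ⟨((2, ⟨0, hpos⟩) : Fin 3 × Fin n),
          Or.inr (Or.inl ⟨rfl, rfl, Or.inr (Or.inr ⟨hin, rfl⟩)⟩), ?_⟩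
        rw [hin] at h3
        have h0 : Even 0 := Even.zero
        change Even 0 ↔ _
        tauto
      · refine ⟨((2, ⟨i + 1, by omega⟩) : Fin 3 × Fin n),
          Or.inr (Or.inl ⟨rfl, rfl, Or.inr (Or.inl rfl)⟩), ?_⟩
        change Even (i + 1) ↔ _
        tauto
  obtain ⟨v, hv, hbox⟩ := h (fun _ => {u | Even u.2.1}) ((0, ⟨0, hpos⟩) : Fin 3 × Fin n)
    (fun v hv => by
      obtain ⟨u, hu, hue⟩ := hends true v hv
      exact ⟨u, hu, hue.2 rfl⟩)
  obtain ⟨u, hu, hue⟩ := hends false v hv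
  exact absurd (hue.1 (hbox u hu)) (by simp)

/-- Two integers agree up to the threshold `t`. -/
def Close (t d d' : ℤ) : Prop :=
  d = d' ∨ (t ≤ d ∧ t ≤ d') ∨ (d ≤ -t ∧ d' ≤ -t)

/-- A finite set of pairs of integers whose differences agree up to the threshold `t`. -/
def PairwiseClose (t : ℤ) (P : Finset (ℤ × ℤ)) : Prop :=
  ∀ p ∈ P, ∀ q ∈ P, Close t (p.1 - q.1) (p.2 - q.2)

lemma PairwiseClose.exists_extension {t : ℤ} (ht : 0 < t) {P : Finset (ℤ × ℤ)}
    (hP : PairwiseClose (2 * t) P) {c : ℤ} {lo hi : ℤ × ℤ} (hlo : lo ∈ P) (hhi : hi ∈ P)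
    (hloc : lo.1 ≤ c) (hchi : c ≤ hi.1) :
    ∃ c', PairwiseClose t (insert (c, c') P) := by
  suffices ∃ c', ∀ q ∈ P, Close t (c - q.1) (c' - q.2) by
    obtain ⟨c', hc'⟩ := this
    refine ⟨c', fun p hp q hq => ?_⟩
    rw [Finset.mem_insert] at hp hq
    rcases hp with rfl | hp <;> rcases hq with rfl | hq
    · left; simp
    · exact hc' q hq
    · have := hc' p hp
      simp only [Close] at this ⊢
      omega
    · have := hP p hp q hq
      simp only [Close] at this ⊢
      omega
  by_cases hnear : ∃ p ∈ P, |c - p.1| ≤ t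
  · obtain ⟨p, hp, hcp⟩ := hnear
    rw [abs_le] at hcp
    refine ⟨p.2 + (c - p.1), fun q hq => ?_⟩
    have := hP p hp q hq
    simp only [Close] at this ⊢
    omega
  · push Not at hnear
    obtain ⟨a, ha, hamax⟩ := (P.filter (fun p => p.1 ≤ c)).exists_max_image Prod.fst
      ⟨lo, Finset.mem_filter.2 ⟨hlo, hloc⟩⟩
    obtain ⟨b, hb, hbmin⟩ := (P.filter (fun p => c ≤ p.1)).exists_min_image Prod.fst
      ⟨hi, Finset.mem_filter.2 ⟨hhi, hchi⟩⟩
    rw [Finset.mem_filter] at ha hb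
    have hca := hnear a ha.1
    have hcb := hnear b hb.1
    rw [abs_of_nonneg (by omega)] at hca
    rw [abs_of_nonpos (by omega)] at hcb
    have hab := hP b hb.1 a ha.1
    refine ⟨a.2 + t, fun q hq => ?_⟩
    have hqa := hP q hq a ha.1
    have hqb := hP q hq b hb.1
    rcases le_total q.1 c with hqc | hqc
    · have := hamax q (Finset.mem_filter.2 ⟨hq, hqc⟩)
      simp only [Close] at hab hqa hqb ⊢
      omega
    · have := hbmin q (Finset.mem_filter.2 ⟨hq, hqc⟩)
      simp only [Close] at hab hqa hqb ⊢
      omega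

/-- The quantifier rank of a formula. -/
def qrank : FO1 → ℕ
  | .eq _ _ => 0
  | .rel _ _ => 0
  | .fal => 0
  | .neg φ => qrank φ
  | .and φ ψ => max (qrank φ) (qrank ψ)
  | .or φ ψ => max (qrank φ) (qrank ψ)
  | .imp φ ψ => max (qrank φ) (qrank ψ)
  | .ex _ φ => qrank φ + 1
  | .all _ φ => qrank φ + 1

/-- The assignments `g` and `g'` restricted to `S` are winning positions for the duplicator in the
`k`-round Ehrenfeucht–Fraïssé game on two cycle frames; `P` records pairs of positions. -/
def Similar (n n' k : ℕ) (S : Finset ℕ) (g : ℕ → (cycleFrame n).W)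
    (g' : ℕ → (cycleFrame n').W) : Prop :=
  ∃ P : Finset (ℤ × ℤ), (0, 0) ∈ P ∧ ((n : ℤ), (n' : ℤ)) ∈ P ∧ PairwiseClose (2 ^ (k + 1)) P ∧
    ∀ x ∈ S, (g x).1 = (g' x).1 ∧ (((g x).2.1 : ℤ), ((g' x).2.1 : ℤ)) ∈ P

variable {n n' k : ℕ} {S : Finset ℕ} {g : ℕ → (cycleFrame n).W} {g' : ℕ → (cycleFrame n').W}

lemma PairwiseClose.mono {s t : ℤ} (hst : s ≤ t) {P : Finset (ℤ × ℤ)}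
    (hP : PairwiseClose t P) : PairwiseClose s P := by
  intro p hp q hq
  have := hP p hp q hq
  simp only [Close] at this ⊢
  omega

lemma Similar.mono {l : ℕ} {T : Finset ℕ} (h : Similar n n' k S g g') (hl : l ≤ k) (hT : T ⊆ S) :
    Similar n n' l T g g' := by
  obtain ⟨P, h0, hn, hP, hS⟩ := h
  exact ⟨P, h0, hn, hP.mono (pow_le_pow_right₀ (by norm_num) (by omega)),
    fun x hx => hS x (hT hx)⟩

lemma Similar.symm (h : Similar n n' k S g g') : Similar n' n k S g' g := by
  obtain ⟨P, h0, hn, hP, hS⟩ := h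
  refine ⟨P.image Prod.swap, Finset.mem_image.2 ⟨_, h0, rfl⟩, Finset.mem_image.2 ⟨_, hn, rfl⟩, ?_,
    fun x hx => ⟨(hS x hx).1.symm, Finset.mem_image.2 ⟨_, (hS x hx).2, rfl⟩⟩⟩
  intro p' hp' q' hq'
  obtain ⟨p, hp, rfl⟩ := Finset.mem_image.1 hp'
  obtain ⟨q, hq, rfl⟩ := Finset.mem_image.1 hq'
  have := hP p hp q hq
  simp only [Close, Prod.fst_swap, Prod.snd_swap] at this ⊢
  omega

lemma Similar.exists_update (h : Similar n n' (k + 1) S g g') (x : ℕ) (d : (cycleFrame n).W) :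
    ∃ d' : (cycleFrame n').W,
      Similar n n' k (insert x S) (Function.update g x d) (Function.update g' x d') := by
  obtain ⟨P, h0, hn, hP, hS⟩ := h
  have ht : (2 : ℤ) ≤ 2 ^ (k + 1) := by
    simpa using pow_le_pow_right₀ (a := (2 : ℤ)) (by norm_num) (Nat.le_add_left 1 k)
  obtain ⟨l, i, hi⟩ := d
  rw [pow_succ' 2 (k + 1)] at hP
  obtain ⟨c', hc'⟩ := hP.exists_extension (by omega) (c := i) h0 hn (by simp)
    (by simpa using hi.le)
  have hlo := hc' _ (Finset.mem_insert_self _ _) _ (Finset.mem_insert_of_mem h0)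
  have hhi := hc' _ (Finset.mem_insert_self _ _) _ (Finset.mem_insert_of_mem hn)
  simp only [Close] at hlo hhi
  lift c' to ℕ using (by omega)
  refine ⟨((l, ⟨c', by omega⟩) : Fin 3 × Fin n'), _, Finset.mem_insert_of_mem h0,
    Finset.mem_insert_of_mem hn, hc', fun y hy => ?_⟩
  by_cases hyx : y = x
  · subst hyx
    simp
  · rw [Function.update_of_ne hyx, Function.update_of_ne hyx]
    have := hS y (Finset.mem_of_mem_insert_of_ne hy hyx)
    exact ⟨this.1, Finset.mem_insert_of_mem this.2⟩

lemma Similar.eq_iff (h : Similar n n' k S g g') {x y : ℕ} (hx : x ∈ S) (hy : y ∈ S) :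
    g x = g y ↔ g' x = g' y := by
  obtain ⟨P, -, -, hP, hS⟩ := h
  have ht : (0 : ℤ) < 2 ^ (k + 1) := by positivity
  have hxy := hP _ (hS x hx).2 _ (hS y hy).2
  simp only [Close] at hxy
  have key : (g x).2.1 = (g y).2.1 ↔ (g' x).2.1 = (g' y).2.1 := by omega
  have e : g x = g y ↔ (g x).1 = (g y).1 ∧ (g x).2.1 = (g y).2.1 :=
    Prod.ext_iff.trans (and_congr_right fun _ => Fin.ext_iff)
  have e' : g' x = g' y ↔ (g' x).1 = (g' y).1 ∧ (g' x).2.1 = (g' y).2.1 :=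
    Prod.ext_iff.trans (and_congr_right fun _ => Fin.ext_iff)
  rw [e, e', key, (hS x hx).1, (hS y hy).1]

lemma Similar.rel_iff (h : Similar n n' k S g g') {x y : ℕ} (hx : x ∈ S) (hy : y ∈ S) :
    (cycleFrame n).R (g x) (g y) ↔ (cycleFrame n').R (g' x) (g' y) := by
  obtain ⟨P, h0, hn, hP, hS⟩ := h
  have ht : (2 : ℤ) ≤ 2 ^ (k + 1) := by
    simpa using pow_le_pow_right₀ (a := (2 : ℤ)) (by norm_num) (Nat.le_add_left 1 k)
  have hyx := hP _ (hS y hy).2 _ (hS x hx).2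
  have hxn := hP _ (hS x hx).2 _ hn
  have hy0 := hP _ (hS y hy).2 _ h0
  simp only [Close] at hyx hxn hy0
  have hsame : (g y).2.1 = (g x).2.1 ↔ (g' y).2.1 = (g' x).2.1 := by omega
  have hnext : (g y).2.1 = (g x).2.1 + 1 ↔ (g' y).2.1 = (g' x).2.1 + 1 := by omega
  have hlast : (g x).2.1 + 1 = n ↔ (g' x).2.1 + 1 = n' := by omega
  have hfirst : (g y).2.1 = 0 ↔ (g' y).2.1 = 0 := by omega
  simp only [hsame, hnext, hlast, hfirst, (hS x hx).1, (hS y hy).1]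

lemma Similar.sat_iff (φ : FO1) {S : Finset ℕ} {g : ℕ → (cycleFrame n).W}
    {g' : ℕ → (cycleFrame n').W} (hφ : φ.freeVars ⊆ S) (h : Similar n n' (qrank φ) S g g') :
    FO1Sat (cycleFrame n) g φ ↔ FO1Sat (cycleFrame n') g' φ := by
  induction φ generalizing S g g' with
  | eq x y => exact h.eq_iff (hφ (by simp [FO1.freeVars])) (hφ (by simp [FO1.freeVars]))
  | rel x y => exact h.rel_iff (hφ (by simp [FO1.freeVars])) (hφ (by simp [FO1.freeVars]))
  | fal => exact Iff.rfl
  | neg φ ih => exact not_congr (ih hφ h)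
  | and φ ψ ih₁ ih₂ =>
    exact and_congr (ih₁ (Finset.union_subset_left hφ) (h.mono (le_max_left _ _) subset_rfl))
      (ih₂ (Finset.union_subset_right hφ) (h.mono (le_max_right _ _) subset_rfl))
  | or φ ψ ih₁ ih₂ =>
    exact or_congr (ih₁ (Finset.union_subset_left hφ) (h.mono (le_max_left _ _) subset_rfl))
      (ih₂ (Finset.union_subset_right hφ) (h.mono (le_max_right _ _) subset_rfl))
  | imp φ ψ ih₁ ih₂ =>
    exact imp_congr (ih₁ (Finset.union_subset_left hφ) (h.mono (le_max_left _ _) subset_rfl))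
      (ih₂ (Finset.union_subset_right hφ) (h.mono (le_max_right _ _) subset_rfl))
  | ex x φ ih =>
    have hφ' : φ.freeVars ⊆ insert x S := by
      exact sdiff_le_iff.1 hφ
    constructor
    · rintro ⟨d, hd⟩
      obtain ⟨d', hd'⟩ := h.exists_update x d
      exact ⟨d', (ih hφ' hd').1 hd⟩
    · rintro ⟨d', hd'⟩
      obtain ⟨d, hd⟩ := h.symm.exists_update x d'
      exact ⟨d, (ih hφ' hd.symm).2 hd'⟩
  | all x φ ih =>
    have hφ' : φ.freeVars ⊆ insert x S := by
      exact sdiff_le_iff.1 hφ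
    constructor
    · intro hall d'
      obtain ⟨d, hd⟩ := h.symm.exists_update x d'
      exact (ih hφ' hd.symm).1 (hall d)
    · intro hall d
      obtain ⟨d', hd'⟩ := h.exists_update x d
      exact (ih hφ' hd').2 (hall d')

lemma similar_empty (hn : 2 ^ (k + 1) ≤ n) (hn' : 2 ^ (k + 1) ≤ n') :
    Similar n n' k ∅ g g' := by
  refine ⟨{(0, 0), ((n : ℤ), (n' : ℤ))}, by simp, by simp, ?_, by simp⟩
  have h1 : (2 : ℤ) ^ (k + 1) ≤ n := by exact_mod_cast hn
  have h2 : (2 : ℤ) ^ (k + 1) ≤ n' := by exact_mod_cast hn'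
  intro p hp q hq
  simp only [Finset.mem_insert, Finset.mem_singleton] at hp hq
  rcases hp with rfl | rfl <;> rcases hq with rfl | rfl <;>
    simp only [Close, true_or] <;> omega

end McKinseyFinite

open McKinseyFinite in
/-- The McKinsey axiom is not first-order definable over finite frames: no
first-order sentence over one binary relation symbol holds in exactly the
finite frames validating `□◇p → ◇□p`. -/
theorem mckinsey_not_fo_definable_finite :
    ¬ ∃ φ : FO1, φ.freeVars = ∅ ∧
        ∀ F : Frame1, Finite F.W → (BValidOn F mckinsey ↔ FrameSat1 F φ) := by
  rintro ⟨φ, hφ, hdef⟩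
  set m := 2 ^ (qrank φ + 1)
  have hmpos : 0 < m := by positivity
  have hodd := (hdef (cycleFrame (2 * m + 1)) inferInstance).1
    (cycleFrame_valid_of_odd (odd_two_mul_add_one m))
  refine cycleFrame_not_valid_of_even (even_two_mul m) (by omega)
    ((hdef (cycleFrame (2 * m)) inferInstance).2 fun g => ?_)
  exact (Similar.sat_iff φ hφ.subset (similar_empty (by omega) (by omega))).1
    (hodd fun _ => ((0, 0) : Fin 3 × Fin (2 * m + 1)))
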